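/- Let M be a natural number, let f be an M-times continuously differentiable function on an open convex subset U of ℝ^d (or ℂ), and let z₁, z₂, ξ ∈ U. Then the difference of Taylor polynomials satisfies P^M_{z₁} f(ξ) − P^M_{z₂} f(ξ) = Σ_{|i⃗| ≤ M} [(ξ−z₁)^{i⃗} / i⃗!] · ( D^{i⃗}f(z₁) − P^{M−|i⃗|}_{z₂}(D^{i⃗}f)(z₁) ). -/

import Mathlib

open MeasureTheory Filter Set
open scoped ENNReal NNReal RealInnerProductSpace

noncomputable section

variable {d : ℕ}

/-- Smooth test functions compactly supported inside `Ω ⊆ ℝ^d`. -/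
def TestOnR (Ω : Set (EuclideanSpace ℝ (Fin d))) (φ : EuclideanSpace ℝ (Fin d) → ℝ) : Prop :=
  ContDiff ℝ (⊤ : ℕ∞) φ ∧ HasCompactSupport φ ∧ tsupport φ ⊆ Ω

/-- `g` is the weak partial derivative of `f` in the `i`-th coordinate direction in `Ω`. -/
def IsWeakPartialR (Ω : Set (EuclideanSpace ℝ (Fin d))) (i : Fin d)
    (f g : EuclideanSpace ℝ (Fin d) → ℝ) : Prop :=
  ∀ φ : EuclideanSpace ℝ (Fin d) → ℝ, TestOnR Ω φ →
    ∫ x in Ω, f x * fderiv ℝ φ x (EuclideanSpace.single i 1) = - ∫ x in Ω, g x * φ x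

/-- `D` is a family of weak derivatives of `f` in `Ω` indexed by multiindices, up to order `n`. -/
def IsWeakDerivFamilyR (Ω : Set (EuclideanSpace ℝ (Fin d))) (n : ℕ)
    (f : EuclideanSpace ℝ (Fin d) → ℝ)
    (D : (Fin d → ℕ) → EuclideanSpace ℝ (Fin d) → ℝ) : Prop :=
  D 0 = f ∧
  (∀ α : Fin d → ℕ, (∑ i, α i) ≤ n → AEStronglyMeasurable (D α) (volume.restrict Ω)) ∧
  (∀ α : Fin d → ℕ, (∑ i, α i) < n → ∀ i : Fin d,
    IsWeakPartialR Ω i (D α) (D (α + Pi.single i 1)))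

/-- Multiindices in `d` variables of total order at most `n`. -/
def multiIdx (d n : ℕ) : Finset (Fin d → ℕ) :=
  (Fintype.piFinset fun _ : Fin d => Finset.range (n + 1)).filter fun α => ∑ i, α i ≤ n

/-- The `W^{n,p}(Ω)` norm of a family of derivatives. -/
def famNormR (n : ℕ) (p : ℝ) (Ω : Set (EuclideanSpace ℝ (Fin d)))
    (D : (Fin d → ℕ) → EuclideanSpace ℝ (Fin d) → ℝ) : ℝ≥0∞ :=
  ∑ α ∈ multiIdx d n, eLpNorm (D α) (ENNReal.ofReal p) (volume.restrict Ω)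

/-- The `W^{n,p}(Ω)` (Sobolev) norm of `f` (it is `∞` when `f ∉ W^{n,p}(Ω)`). -/
def sobNormR (n : ℕ) (p : ℝ) (Ω : Set (EuclideanSpace ℝ (Fin d)))
    (f : EuclideanSpace ℝ (Fin d) → ℝ) : ℝ≥0∞ :=
  ⨅ (D : (Fin d → ℕ) → EuclideanSpace ℝ (Fin d) → ℝ)
    (_ : IsWeakDerivFamilyR Ω n f D), famNormR n p Ω D

/-- Membership in the Sobolev space `W^{n,p}(Ω)`, `Ω ⊆ ℝ^d`. -/
def MemSobolevR (n : ℕ) (p : ℝ) (Ω : Set (EuclideanSpace ℝ (Fin d)))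
    (f : EuclideanSpace ℝ (Fin d) → ℝ) : Prop :=
  sobNormR n p Ω f < ⊤

/-- `Ω` is a Sobolev `W^{n,p}` extension domain. -/
def IsExtensionDomain (n : ℕ) (p : ℝ) (Ω : Set (EuclideanSpace ℝ (Fin d))) : Prop :=
  ∃ (Ext : (EuclideanSpace ℝ (Fin d) → ℝ) → EuclideanSpace ℝ (Fin d) → ℝ) (C : ℝ≥0∞),
    C ≠ ⊤ ∧ ∀ f, MemSobolevR n p Ω f →
      (Ext f =ᵐ[volume.restrict Ω] f) ∧
      sobNormR n p Set.univ (Ext f) ≤ C * sobNormR n p Ω f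

/-- `Ω ⊆ ℝ^d` is a Lipschitz domain with character `(δ, R)`: near every boundary point,
`Ω` is the region above the graph of a `δ`-Lipschitz function. -/
def IsLipschitzDomainWithR (Ω : Set (EuclideanSpace ℝ (Fin d))) (δ : ℝ≥0) (R : ℝ) : Prop :=
  IsOpen Ω ∧ IsConnected Ω ∧ Bornology.IsBounded Ω ∧ 0 < R ∧
  ∀ x ∈ frontier Ω, ∃ v : EuclideanSpace ℝ (Fin d), ‖v‖ = 1 ∧
    ∃ A : EuclideanSpace ℝ (Fin d) → ℝ, LipschitzWith δ A ∧
      ∀ w ∈ Metric.ball x R, (w ∈ Ω ↔ A (w - x - ⟪w - x, v⟫ • v) < ⟪w - x, v⟫)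

/-- `Ω ⊆ ℝ^d` is a bounded Lipschitz domain. -/
def IsLipschitzDomainR (Ω : Set (EuclideanSpace ℝ (Fin d))) : Prop :=
  ∃ δ R, IsLipschitzDomainWithR Ω δ R

end

noncomputable section

/-- The multiindex partial derivative `D^α f` (iterated partial derivatives). -/
def mD {d : ℕ} (α : Fin d → ℕ) (f : EuclideanSpace ℝ (Fin d) → ℝ) :
    EuclideanSpace ℝ (Fin d) → ℝ :=
  (List.finRange d).foldr
    (fun i g => (fun h y => fderiv ℝ h y (EuclideanSpace.single i 1))^[α i] g) f

/-- The Taylor polynomial of degree `M` of `f` centered at `z`, evaluated at `ξ`: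
`P^M_z f (ξ) = Σ_{|α| ≤ M} D^α f(z) (ξ-z)^α / α!`. -/
def taylorPoly {d : ℕ} (M : ℕ) (f : EuclideanSpace ℝ (Fin d) → ℝ)
    (z ξ : EuclideanSpace ℝ (Fin d)) : ℝ :=
  ∑ α ∈ multiIdx d M,
    mD α f z * (∏ i, (ξ i - z i) ^ α i) / ∏ i, ((α i).factorial : ℝ)

end

noncomputable section

/-- Functions equal on an open set have equal directional derivatives there. -/
theorem fderiv_apply_eqOn {E : Type*} [NormedAddCommGroup E] [NormedSpace ℝ E] {U : Set E}
    (hU : IsOpen U) {f g : E → ℝ} (h : EqOn f g U) (v : E) :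
    EqOn (fun y => fderiv ℝ f y v) (fun y => fderiv ℝ g y v) U := by
  intro y hy
  have : f =ᶠ[nhds y] g := h.eventuallyEq_of_mem (hU.mem_nhds hy)
  simp only [this.fderiv_eq]

theorem ContDiffOn.fderiv_apply_of_isOpen {E : Type*} [NormedAddCommGroup E] [NormedSpace ℝ E]
    {U : Set E} (hU : IsOpen U) {f : E → ℝ} {n : ℕ} (hf : ContDiffOn ℝ (n + 1 : ℕ) f U) (v : E) :
    ContDiffOn ℝ n (fun y => fderiv ℝ f y v) U :=
  (hf.fderiv_of_isOpen hU (by norm_cast)).clm_apply contDiffOn_const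

theorem fderiv_apply_comm_eqOn {E : Type*} [NormedAddCommGroup E] [NormedSpace ℝ E] {U : Set E}
    (hU : IsOpen U) {f : E → ℝ} (hf : ContDiffOn ℝ 2 f U) (v w : E) :
    EqOn (fun y => fderiv ℝ (fun x => fderiv ℝ f x w) y v)
      (fun y => fderiv ℝ (fun x => fderiv ℝ f x v) y w) U := by
  intro y hy
  have hfy : ContDiffAt ℝ 2 f y := hf.contDiffAt (hU.mem_nhds hy)
  have hd : DifferentiableAt ℝ (fderiv ℝ f) y :=
    (hfy.fderiv_right (m := 1) (by norm_num)).differentiableAt (by norm_num)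
  have key (a b : E) : fderiv ℝ (fun x => fderiv ℝ f x a) y b = fderiv ℝ (fderiv ℝ f) y b a := by
    rw [fderiv_clm_apply hd (differentiableAt_const a)]
    simp
  simp only [key]
  exact hfy.isSymmSndFDerivAt (by simp) v w

/-- Iterated directional derivatives along a list of vectors; the last vector acts first. -/
def listDeriv {E : Type*} [NormedAddCommGroup E] [NormedSpace ℝ E] (l : List E) (f : E → ℝ) :
    E → ℝ :=
  l.foldr (fun v g y => fderiv ℝ g y v) f

theorem ContDiffOn.listDeriv {E : Type*} [NormedAddCommGroup E] [NormedSpace ℝ E] {U : Set E}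
    (hU : IsOpen U) {f : E → ℝ} (l : List E) (n : ℕ) (hf : ContDiffOn ℝ (n + l.length : ℕ) f U) :
    ContDiffOn ℝ n (listDeriv l f) U := by
  induction l generalizing n with
  | nil => exact hf
  | cons v l ih =>
    refine ContDiffOn.fderiv_apply_of_isOpen hU (ih (n + 1) ?_) v
    convert hf using 2
    simp only [List.length_cons]
    ring

theorem List.Perm.listDeriv_eqOn {E : Type*} [NormedAddCommGroup E] [NormedSpace ℝ E] {U : Set E}
    (hU : IsOpen U) {f : E → ℝ} {l l' : List E} (h : l.Perm l')
    (hf : ContDiffOn ℝ l.length f U) : EqOn (listDeriv l f) (listDeriv l' f) U := by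
  induction h with
  | nil => exact fun _ _ => rfl
  | cons v _ ih => exact fderiv_apply_eqOn hU (ih (hf.of_le (by simp))) v
  | swap v w l =>
    refine fderiv_apply_comm_eqOn hU (ContDiffOn.listDeriv hU l 2 ?_) w v
    convert hf using 2
    simp only [List.length_cons]
    ring
  | trans h₁ _ ih₁ ih₂ => exact (ih₁ hf).trans (ih₂ (h₁.length_eq ▸ hf))

/-- The list of coordinate directions of a multiindex, with multiplicity. -/
def multiIdxDirections {d : ℕ} (α : Fin d → ℕ) : List (EuclideanSpace ℝ (Fin d)) :=
  (List.finRange d).flatMap fun i => List.replicate (α i) (EuclideanSpace.single i 1)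

theorem length_multiIdxDirections {d : ℕ} (α : Fin d → ℕ) :
    (multiIdxDirections α).length = ∑ i, α i := by
  simp [multiIdxDirections, List.length_flatMap, Fin.sum_univ_def]

theorem multiIdxDirections_append_perm {d : ℕ} (α β : Fin d → ℕ) :
    (multiIdxDirections α ++ multiIdxDirections β).Perm (multiIdxDirections (α + β)) := by
  simp only [multiIdxDirections, Pi.add_apply, List.replicate_add]
  exact List.flatMap_append_perm _ _ _

theorem listDeriv_append {E : Type*} [NormedAddCommGroup E] [NormedSpace ℝ E] (l l' : List E)
    (f : E → ℝ) : listDeriv (l ++ l') f = listDeriv l (listDeriv l' f) :=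
  List.foldr_append

theorem listDeriv_replicate {E : Type*} [NormedAddCommGroup E] [NormedSpace ℝ E] (n : ℕ) (v : E)
    (f : E → ℝ) : listDeriv (List.replicate n v) f = (fun h y => fderiv ℝ h y v)^[n] f := by
  induction n with
  | zero => rfl
  | succ n ih =>
    rw [Function.iterate_succ_apply', ← ih]
    rfl

theorem mD_eq_listDeriv {d : ℕ} (α : Fin d → ℕ) (f : EuclideanSpace ℝ (Fin d) → ℝ) :
    mD α f = listDeriv (multiIdxDirections α) f := by
  unfold mD multiIdxDirections
  induction List.finRange d with
  | nil => rfl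
  | cons i l ih =>
    rw [List.foldr_cons, ih, List.flatMap_cons, listDeriv_append, listDeriv_replicate]

theorem mD_mD_eqOn {d : ℕ} {U : Set (EuclideanSpace ℝ (Fin d))} (hU : IsOpen U)
    {f : EuclideanSpace ℝ (Fin d) → ℝ} {M : ℕ} (hf : ContDiffOn ℝ M f U) {α β : Fin d → ℕ}
    (h : ∑ i, α i + ∑ i, β i ≤ M) : EqOn (mD β (mD α f)) (mD (α + β) f) U := by
  simp only [mD_eq_listDeriv, ← listDeriv_append]
  rw [add_comm α β]
  refine (multiIdxDirections_append_perm β α).listDeriv_eqOn hU (hf.of_le ?_)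
  rw [List.length_append, length_multiIdxDirections, length_multiIdxDirections, add_comm]
  exact_mod_cast h

theorem mem_multiIdx {d n : ℕ} {α : Fin d → ℕ} : α ∈ multiIdx d n ↔ ∑ i, α i ≤ n := by
  simp only [multiIdx, Finset.mem_filter, Fintype.mem_piFinset, Finset.mem_range,
    Nat.lt_succ_iff, and_iff_right_iff_imp]
  exact fun h i => (Finset.single_le_sum (fun j _ => Nat.zero_le (α j)) (Finset.mem_univ i)).trans h

theorem sum_multiIdx_sum_le {d : ℕ} (M : ℕ) (F : (Fin d → ℕ) → (Fin d → ℕ) → ℝ) :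
    ∑ γ ∈ multiIdx d M, ∑ α ∈ Fintype.piFinset fun i => Finset.range (γ i + 1), F α (γ - α) =
      ∑ α ∈ multiIdx d M, ∑ β ∈ multiIdx d (M - ∑ i, α i), F α β := by
  rw [Finset.sum_sigma', Finset.sum_sigma']
  refine Finset.sum_bij' (fun p _ => ⟨p.2, p.1 - p.2⟩) (fun p _ => ⟨p.1 + p.2, p.1⟩) ?_ ?_ ?_ ?_ ?_
  · rintro ⟨γ, α⟩ h
    simp only [Finset.mem_sigma, mem_multiIdx, Fintype.mem_piFinset, Finset.mem_range,
      Nat.lt_succ_iff] at h ⊢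
    have hsum : ∑ i, (γ - α) i + ∑ i, α i = ∑ i, γ i := by
      rw [← Finset.sum_add_distrib]
      exact Finset.sum_congr rfl fun i _ => Nat.sub_add_cancel (h.2 i)
    omega
  · rintro ⟨α, β⟩ h
    simp only [Finset.mem_sigma, mem_multiIdx, Fintype.mem_piFinset, Finset.mem_range,
      Pi.add_apply, Finset.sum_add_distrib] at h ⊢
    exact ⟨by omega, fun i => by omega⟩
  · rintro ⟨γ, α⟩ h
    simp only [Finset.mem_sigma, Fintype.mem_piFinset, Finset.mem_range, Nat.lt_succ_iff] at h
    simp only [add_tsub_cancel_of_le (show α ≤ γ from h.2)]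
  · rintro ⟨α, β⟩ _
    simp only [add_tsub_cancel_left]
  · exact fun _ _ => rfl

/-- The binomial theorem in terms of divided powers. -/
theorem add_pow_div_factorial (x y : ℝ) (n : ℕ) :
    (x + y) ^ n / (n.factorial : ℝ) = ∑ k ∈ Finset.range (n + 1),
      x ^ k / (k.factorial : ℝ) * (y ^ (n - k) / ((n - k).factorial : ℝ)) := by
  rw [add_pow, Finset.sum_div]
  refine Finset.sum_congr rfl fun k hk => ?_
  rw [Nat.cast_choose ℝ (Nat.lt_succ_iff.mp (Finset.mem_range.mp hk))]
  field_simp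

/-- The multinomial version of the binomial theorem in terms of divided powers. -/
theorem prod_add_pow_div_factorial {d : ℕ} (x y : Fin d → ℝ) (γ : Fin d → ℕ) :
    (∏ i, (x i + y i) ^ γ i) / ∏ i, ((γ i).factorial : ℝ) =
      ∑ α ∈ Fintype.piFinset fun i => Finset.range (γ i + 1),
        ((∏ i, x i ^ α i) / ∏ i, ((α i).factorial : ℝ)) *
          ((∏ i, y i ^ (γ - α) i) / ∏ i, (((γ - α) i).factorial : ℝ)) := by
  simp only [← Finset.prod_div_distrib, add_pow_div_factorial, Finset.prod_univ_sum,
    ← Finset.prod_mul_distrib, Pi.sub_apply]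

/-- Recentering a Taylor polynomial: its own Taylor coefficients at `z₁` are the Taylor
polynomials of the derivatives. -/
theorem taylorPoly_recenter {d M : ℕ} {U : Set (EuclideanSpace ℝ (Fin d))} (hU : IsOpen U)
    {f : EuclideanSpace ℝ (Fin d) → ℝ} (hf : ContDiffOn ℝ M f U)
    {z₂ : EuclideanSpace ℝ (Fin d)} (hz₂ : z₂ ∈ U) (z₁ ξ : EuclideanSpace ℝ (Fin d)) :
    taylorPoly M f z₂ ξ = ∑ α ∈ multiIdx d M,
      ((∏ i, (ξ i - z₁ i) ^ α i) / ∏ i, ((α i).factorial : ℝ)) *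
        taylorPoly (M - ∑ i, α i) (mD α f) z₂ z₁ := by
  let F (α β : Fin d → ℕ) : ℝ := mD (α + β) f z₂ *
    (((∏ i, (ξ i - z₁ i) ^ α i) / ∏ i, ((α i).factorial : ℝ)) *
      ((∏ i, (z₁ i - z₂ i) ^ β i) / ∏ i, ((β i).factorial : ℝ)))
  trans ∑ γ ∈ multiIdx d M, ∑ α ∈ Fintype.piFinset fun i => Finset.range (γ i + 1), F α (γ - α)
  · refine Finset.sum_congr rfl fun γ _ => ?_
    have hx (i : Fin d) : ξ i - z₂ i = (ξ i - z₁ i) + (z₁ i - z₂ i) := by ring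
    simp only [hx]
    rw [mul_div_assoc, prod_add_pow_div_factorial, Finset.mul_sum]
    refine Finset.sum_congr rfl fun α hα => ?_
    have hle : α ≤ γ := fun i =>
      Nat.lt_succ_iff.mp (Finset.mem_range.mp (Fintype.mem_piFinset.mp hα i))
    simp only [F, add_tsub_cancel_of_le hle]
  · rw [sum_multiIdx_sum_le]
    refine Finset.sum_congr rfl fun α hα => ?_
    rw [taylorPoly, Finset.mul_sum]
    refine Finset.sum_congr rfl fun β hβ => ?_
    rw [mem_multiIdx] at hα hβ
    rw [mD_mD_eqOn hU hf (by omega) hz₂]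
    simp only [F]
    ring

/-- For an `M`-times continuously differentiable function on an open
convex set `U ⊆ ℝ^d`, the difference of Taylor polynomials centered at `z₁` and `z₂`
satisfies
`P^M_{z₁} f(ξ) - P^M_{z₂} f(ξ)
  = Σ_{|α| ≤ M} ((ξ-z₁)^α/α!) (D^α f(z₁) - P^{M-|α|}_{z₂}(D^α f)(z₁))`. -/
theorem taylor_poly_difference
    (d : ℕ) (hd : 0 < d) (M : ℕ) (U : Set (EuclideanSpace ℝ (Fin d)))
    (hU : IsOpen U) (hconv : Convex ℝ U)
    (f : EuclideanSpace ℝ (Fin d) → ℝ) (hf : ContDiffOn ℝ M f U)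
    (z₁ z₂ ξ : EuclideanSpace ℝ (Fin d))
    (hz₁ : z₁ ∈ U) (hz₂ : z₂ ∈ U) (hξ : ξ ∈ U) :
    taylorPoly M f z₁ ξ - taylorPoly M f z₂ ξ =
      ∑ α ∈ multiIdx d M,
        ((∏ i, (ξ i - z₁ i) ^ α i) / ∏ i, ((α i).factorial : ℝ)) *
          (mD α f z₁ - taylorPoly (M - ∑ i, α i) (mD α f) z₂ z₁) := by
  rw [taylorPoly_recenter hU hf hz₂ z₁ ξ, taylorPoly, ← Finset.sum_sub_distrib]
  exact Finset.sum_congr rfl fun α _ => by ring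

end
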